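/- Let d ≥ 2 and, for n ∈ ℕ, let U_n = (u₁ⁿ, u₂, …, u_d) with u₁ⁿ, u₂, …, u_d ∈ C²(ℝ^d) having ℤ^d-periodic gradients (∇U_n ∈ C¹_♯(Y_d)^{d×d}), and let a ∈ C¹_♯(Y_d) be positive. Assume det(∇U_n) > 0 on ℝ^d, that ρ_n := 1/(a det(∇U_n)) converges uniformly on ℝ^d to some ρ ∈ C¹_♯(Y_d), and that ρ ≤ ρ_n. Define Φ := a R⊥∇u₂ if d = 2 and Φ := a (∇u₂ × ⋯ × ∇u_d) if d > 2, and set b_n := ρ_nΦ, b := ρΦ. Then (b_n) converges uniformly to b, and with m := (∫_{Y_d} dy/(a(y)ρ(y)))^{-1} and V := ∫_{Y₂} R⊥∇u₂(y) dy if d = 2, V := ∫_{Y_d} (∇u₂ × ⋯ × ∇u_d)(y) dy if d > 2: (i) if ρ is positive everywhere, then for all x ∈ ℝ^d, X(t,x)/t → m V as t → ∞; (ii) if ρ vanishes at some point and m = 0, then for all x, X(t,x)/t → 0; (iii) if ρ vanishes at some point and m > 0, then C_b = [0,ζ] := {sζ : s ∈ [0,1]} with ζ := m V ≠ 0. -/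

import Mathlib

open MeasureTheory Filter Matrix

noncomputable section

/-- A function on `ℝ^d` is `ℤ^d`-periodic. -/
def ZdPeriodic {d : ℕ} {E : Type*} (f : (Fin d → ℝ) → E) : Prop :=
  ∀ (κ : Fin d → ℤ) (x : Fin d → ℝ), f (x + fun i => (κ i : ℝ)) = f x

/-- The unit cube `[0,1)^d`, a fundamental domain for the torus `Y_d = ℝ^d/ℤ^d`. -/
def unitCube (d : ℕ) : Set (Fin d → ℝ) := {x | ∀ i, x i ∈ Set.Ico (0 : ℝ) 1}

/-- `X` is the global flow of the vector field `b`: `∂X/∂t(t,x) = b(X(t,x))`, `X(0,x) = x`. -/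
def IsFlowOf {d : ℕ} (b : (Fin d → ℝ) → (Fin d → ℝ))
    (X : ℝ → (Fin d → ℝ) → (Fin d → ℝ)) : Prop :=
  ∀ x : Fin d → ℝ, X 0 x = x ∧ ∀ t : ℝ, HasDerivAt (fun s => X s x) (b (X t x)) t

/-- A measure `μ` on the torus `Y_d` (identified with a measure on `ℝ^d` carried by the unit
cube) is invariant for the flow `X`: `∫ ψ(X(t,y)) dμ = ∫ ψ dμ` for all `t` and all continuous
`ℤ^d`-periodic `ψ`. -/
def FlowInvariant {d : ℕ} (X : ℝ → (Fin d → ℝ) → (Fin d → ℝ))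
    (μ : Measure (Fin d → ℝ)) : Prop :=
  ∀ (t : ℝ) (ψ : (Fin d → ℝ) → ℝ), Continuous ψ → ZdPeriodic ψ →
    ∫ y, ψ (X t y) ∂μ = ∫ y, ψ y ∂μ

/-- Herman's rotation set `C_b = {∫ b dμ : μ invariant probability measure for the flow}`. -/
def rotationSet {d : ℕ} (b : (Fin d → ℝ) → (Fin d → ℝ))
    (X : ℝ → (Fin d → ℝ) → (Fin d → ℝ)) : Set (Fin d → ℝ) :=
  {ζ | ∃ μ : Measure (Fin d → ℝ), IsProbabilityMeasure μ ∧ μ (unitCube d)ᶜ = 0 ∧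
        FlowInvariant X μ ∧ ζ = ∫ y, b y ∂μ}

/-- The gradient of a scalar function on `ℝ^d`. -/
def grad {d : ℕ} (ψ : (Fin d → ℝ) → ℝ) (y : Fin d → ℝ) : Fin d → ℝ :=
  fun i => fderiv ℝ ψ y (Pi.single i 1)

/-- The generalized cross product of the vectors `v 1, …, v (d-1)` (the entry `v 0` is
ignored): the unique vector `w ∈ ℝ^d` such that `w·x = det[x, v 1, …, v (d-1)]` (columns) for
all `x ∈ ℝ^d`. For `d = 2` it coincides with the rotation `R⊥ (v 1)` by `−π/2`. -/
def gcross {d : ℕ} (v : Fin d → Fin d → ℝ) : Fin d → ℝ := fun i =>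
  Matrix.det (Matrix.of fun r c : Fin d => if (c : ℕ) = 0 then (Pi.single i 1 : Fin d → ℝ) r else v c r)

section Periodic

variable {d : ℕ} {E : Type*}

theorem unitCube_eq_fundamentalDomain :
    unitCube d = ZSpan.fundamentalDomain (Pi.basisFun ℝ (Fin d)) := rfl

theorem measurableSet_unitCube : MeasurableSet (unitCube d) := by
  rw [unitCube_eq_fundamentalDomain]
  exact ZSpan.fundamentalDomain_measurableSet _

theorem unitCube_subset_Icc : unitCube d ⊆ Set.Icc 0 1 :=
  fun _ hx => ⟨fun i => (hx i).1, fun i => (hx i).2.le⟩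

theorem volume_unitCube : volume (unitCube d) = 1 := by
  rw [unitCube_eq_fundamentalDomain, ZSpan.fundamentalDomain_pi_basisFun, Real.volume_pi_Ico]
  simp

theorem isProbabilityMeasure_restrict_unitCube :
    IsProbabilityMeasure (volume.restrict (unitCube d)) :=
  ⟨by rw [Measure.restrict_apply_univ, volume_unitCube]⟩

theorem fract_mem_unitCube (x : Fin d → ℝ) : (fun i => Int.fract (x i)) ∈ unitCube d :=
  fun _ => ⟨Int.fract_nonneg _, Int.fract_lt_one _⟩

theorem ZdPeriodic.apply_fract {f : (Fin d → ℝ) → E} (hf : ZdPeriodic f) (x : Fin d → ℝ) :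
    f (fun j => Int.fract (x j)) = f x := by
  rw [← hf (fun j => ⌊x j⌋)]
  congr 1
  ext
  simp

theorem ZdPeriodic.exists_bound [NormedAddCommGroup E] {f : (Fin d → ℝ) → E} (hf : ZdPeriodic f)
    (hc : Continuous f) : ∃ C, 0 < C ∧ ∀ x, ‖f x‖ ≤ C := by
  obtain ⟨C, hC⟩ := (isCompact_Icc (a := (0 : Fin d → ℝ)) (b := 1)).exists_bound_of_continuousOn
    hc.continuousOn
  refine ⟨max C 1, by positivity, fun x => ?_⟩
  rw [← hf.apply_fract]
  exact (hC _ (unitCube_subset_Icc (fract_mem_unitCube x))).trans (le_max_left _ _)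

theorem ZdPeriodic.exists_isMaxOn {f : (Fin d → ℝ) → ℝ} (hf : ZdPeriodic f)
    (hc : Continuous f) : ∃ x, ∀ y, f y ≤ f x := by
  obtain ⟨x, -, hx⟩ := (isCompact_Icc (a := (0 : Fin d → ℝ)) (b := 1)).exists_isMaxOn
    ⟨0, by simp⟩ hc.continuousOn
  refine ⟨x, fun y => ?_⟩
  rw [← hf.apply_fract y]
  exact hx (unitCube_subset_Icc (fract_mem_unitCube y))

theorem ZdPeriodic.fderiv [NormedAddCommGroup E] [NormedSpace ℝ E] {f : (Fin d → ℝ) → E}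
    (hf : ZdPeriodic f) : ZdPeriodic (fderiv ℝ f) := by
  intro κ x
  rw [← fderiv_comp_add_right, funext (hf κ)]

theorem ZdPeriodic.exists_lipschitzWith [NormedAddCommGroup E] [NormedSpace ℝ E]
    {f : (Fin d → ℝ) → E} (hf : ZdPeriodic f) (hc : ContDiff ℝ 1 f) :
    ∃ K, LipschitzWith K f := by
  obtain ⟨C, hC0, hC⟩ := hf.fderiv.exists_bound (hc.continuous_fderiv one_ne_zero)
  exact ⟨⟨C, hC0.le⟩, lipschitzWith_of_nnnorm_fderiv_le (hc.differentiable one_ne_zero)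
    fun x => hC x⟩

theorem ZdPeriodic.mem_span_add {f : (Fin d → ℝ) → E} (hf : ZdPeriodic f)
    (g : (Submodule.span ℤ (Set.range (Pi.basisFun ℝ (Fin d)))).toAddSubgroup) (x : Fin d → ℝ) :
    f (g +ᵥ x) = f x := by
  have : ∀ i, ∃ n : ℤ, (g : Fin d → ℝ) i = n := by
    intro i
    obtain ⟨n, hn⟩ := (Module.Basis.mem_span_iff_repr_mem ℤ (Pi.basisFun ℝ (Fin d)) g).1 g.2 i
    exact ⟨n, by simpa using hn.symm⟩
  choose n hn using this
  rw [← hf n x]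
  congr 1
  ext i
  simp [AddSubgroup.vadd_def, hn, add_comm]

theorem ZdPeriodic.setIntegral_add_right [NormedAddCommGroup E] [NormedSpace ℝ E]
    {f : (Fin d → ℝ) → E} (hf : ZdPeriodic f) (h : Fin d → ℝ) :
    ∫ y in unitCube d, f (y + h) = ∫ y in unitCube d, f y := by
  have hD := ZSpan.isAddFundamentalDomain' (Pi.basisFun ℝ (Fin d)) volume
  have : Countable (Submodule.span ℤ (Set.range (Pi.basisFun ℝ (Fin d)))).toAddSubgroup :=
    inferInstanceAs (Countable (Submodule.span ℤ (Set.range (Pi.basisFun ℝ (Fin d)))))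
  have := (hD.vadd_of_comm h).setIntegral_eq hD hf.mem_span_add
  rw [unitCube_eq_fundamentalDomain, ← this]
  simp_rw [add_comm _ h]
  exact ((measurePreserving_vadd h volume).setIntegral_image_emb
    (measurableEmbedding_const_vadd h) _ _).symm

end Periodic

section DivergenceFree

variable {d : ℕ}

theorem LipschitzWith.integrable_fderiv_apply {ψ : (Fin d → ℝ) → ℝ} {K : NNReal}
    (hψ : LipschitzWith K ψ) {W : (Fin d → ℝ) → Fin d → ℝ} (hW : Continuous W) {C : ℝ}
    (hC : ∀ x, ‖W x‖ ≤ C) (μ : Measure (Fin d → ℝ)) [IsFiniteMeasure μ] :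
    Integrable (fun y => fderiv ℝ ψ y (W y)) μ := by
  refine Integrable.of_bound (C := K * C) ?_ (ae_of_all _ fun y => ?_)
  · have h1 := measurable_fderiv ℝ ψ
    exact ((ContinuousLinearMap.apply ℝ ℝ).flip.isBoundedBilinearMap.continuous.measurable.comp
      (h1.prodMk hW.measurable)).aestronglyMeasurable
  · exact (ContinuousLinearMap.le_opNorm _ _).trans (mul_le_mul (norm_fderiv_le_of_lipschitz ℝ hψ)
      (hC y) (norm_nonneg _) K.2)

/-- Difference quotients of a Lipschitz function along translations, tested against a bounded
function, converge. -/
theorem LipschitzWith.hasDerivAt_setIntegral_translate {ψ w : (Fin d → ℝ) → ℝ} {K : NNReal}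
    (hψ : LipschitzWith K ψ) (hψb : ∃ C, ∀ x, ‖ψ x‖ ≤ C) (hw : Continuous w)
    (hwb : ∃ C, ∀ x, ‖w x‖ ≤ C) (v : Fin d → ℝ) :
    HasDerivAt (fun h : ℝ => ∫ y in unitCube d, ψ (y + h • v) * w y)
      (∫ y in unitCube d, fderiv ℝ ψ y v * w y) 0 := by
  obtain ⟨B, hB⟩ := hψb
  obtain ⟨C, hC⟩ := hwb
  have := isProbabilityMeasure_restrict_unitCube (d := d)
  have hC0 : 0 ≤ C := (norm_nonneg _).trans (hC 0)
  have hB0 : 0 ≤ B := (norm_nonneg _).trans (hB 0)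
  refine (hasDerivAt_integral_of_dominated_loc_of_lip (s := Set.univ)
    (bound := fun _ => K * ‖v‖ * C)
    Filter.univ_mem ?_ ?_ ?_ ?_ (integrable_const _) ?_).2
  · refine Filter.Eventually.of_forall fun h => Continuous.aestronglyMeasurable ?_
    have := hψ.continuous
    fun_prop
  · refine Integrable.of_bound (C := B * C) ?_ (ae_of_all _ fun y => ?_)
    · have := hψ.continuous
      exact Continuous.aestronglyMeasurable (by fun_prop)
    · rw [norm_mul]
      exact mul_le_mul (hB _) (hC _) (norm_nonneg _) hB0
  · exact ((measurable_fderiv_apply_const ℝ ψ v).mul hw.measurable).aestronglyMeasurable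
  · refine ae_of_all _ fun y => LipschitzOnWith.of_dist_le_mul fun s _ t _ => ?_
    rw [Real.coe_nnabs, abs_of_nonneg (by positivity), Real.dist_eq, ← sub_mul, abs_mul]
    have h1 : |ψ (y + s • v) - ψ (y + t • v)| ≤ K * (‖v‖ * dist s t) := by
      rw [← Real.dist_eq]
      refine (hψ.dist_le_mul _ _).trans (mul_le_mul_of_nonneg_left ?_ K.2)
      rw [dist_add_left, dist_eq_norm, ← sub_smul, norm_smul, Real.dist_eq, mul_comm,
        Real.norm_eq_abs]
    calc _ ≤ (K * (‖v‖ * dist s t)) * C := mul_le_mul h1 (hC y) (abs_nonneg _) (by positivity)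
      _ = _ := by ring
  · filter_upwards [ae_restrict_of_ae hψ.ae_differentiableAt] with y hy
    have h1 : HasDerivAt (fun h : ℝ => y + h • v) v 0 := by
      simpa using ((hasDerivAt_id (0 : ℝ)).smul_const v).const_add y
    have h2 : HasFDerivAt ψ (fderiv ℝ ψ y) (y + (0 : ℝ) • v) := by simpa using hy.hasFDerivAt
    exact (h2.comp_hasDerivAt (0 : ℝ) h1).mul_const _

theorem integral_fderiv_apply_eq_zero {ψ : (Fin d → ℝ) → ℝ} {K : NNReal}
    (hψ : LipschitzWith K ψ) (hψper : ZdPeriodic ψ) {W : (Fin d → ℝ) → Fin d → ℝ}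
    (hW : ContDiff ℝ 1 W) (hWper : ZdPeriodic W)
    (hdiv : ∀ y, ∑ i, fderiv ℝ W y (Pi.single i 1) i = 0) :
    ∫ y in unitCube d, fderiv ℝ ψ y (W y) = 0 := by
  have := isProbabilityMeasure_restrict_unitCube (d := d)
  obtain ⟨B, hB0, hB⟩ := hψper.exists_bound hψ.continuous
  obtain ⟨C, hC0, hC⟩ := hWper.exists_bound hW.continuous
  obtain ⟨L, hL⟩ := hWper.exists_lipschitzWith hW
  have hcomp : ∀ i, LipschitzWith L (fun y => W y i) := fun i =>
    LipschitzWith.of_dist_le_mul fun x y =>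
      (dist_le_pi_dist (W x) (W y) i).trans (hL.dist_le_mul x y)
  have hCi : ∀ i x, ‖W x i‖ ≤ C := fun i x => (norm_le_pi_norm (W x) i).trans (hC x)
  have hpart : ∀ i, ∫ y in unitCube d, fderiv ℝ ψ y (Pi.single i 1) * W y i =
      - ∫ y in unitCube d, ψ y * fderiv ℝ W y (Pi.single i 1) i := by
    intro i
    have h1 := hψ.hasDerivAt_setIntegral_translate ⟨B, hB⟩ (hcomp i).continuous ⟨C, hCi i⟩
      (Pi.single i 1)
    have h2 := (hcomp i).hasDerivAt_setIntegral_translate ⟨C, hCi i⟩ hψ.continuous ⟨B, hB⟩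
      (-Pi.single i 1)
    have h3 : (fun h : ℝ => ∫ y in unitCube d, ψ (y + h • Pi.single i 1) * W y i) =
        fun h : ℝ => ∫ y in unitCube d, W (y + h • -Pi.single i 1) i * ψ y := by
      ext h
      have hper : ZdPeriodic fun y => ψ (y + h • Pi.single i 1) * W y i := by
        intro κ x
        dsimp only
        rw [add_right_comm x, hψper κ, hWper κ]
      rw [← hper.setIntegral_add_right (h • -Pi.single i 1)]
      congr 1
      ext y
      simp [mul_comm]
    rw [h3] at h1
    rw [h1.unique h2, ← integral_neg]
    congr 1
    ext y
    have : fderiv ℝ (fun y => W y i) y = (ContinuousLinearMap.proj i).comp (fderiv ℝ W y) :=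
      ((hasFDerivAt_pi'.1 (hW.differentiable one_ne_zero y).hasFDerivAt) i).fderiv
    rw [this]
    simp [mul_comm]
  have hexp : ∀ y, fderiv ℝ ψ y (W y) = ∑ i, fderiv ℝ ψ y (Pi.single i 1) * W y i := by
    intro y
    conv_lhs => rw [pi_eq_sum_univ' (W y)]
    rw [map_sum]
    refine Finset.sum_congr rfl fun i _ => ?_
    rw [map_smul, smul_eq_mul, mul_comm]
  simp_rw [hexp]
  rw [integral_finsetSum]
  · simp_rw [hpart]
    rw [Finset.sum_neg_distrib, ← integral_finsetSum]
    · simp_rw [← Finset.mul_sum, hdiv]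
      simp
    · intro i _
      have : Continuous fun y => ψ y * fderiv ℝ W y (Pi.single i 1) i := by
        have h1 := hW.continuous_fderiv one_ne_zero
        have h2 := hψ.continuous
        fun_prop
      exact (this.continuousOn.integrableOn_compact
        (isCompact_Icc (a := (0 : Fin d → ℝ)) (b := 1))).mono_set unitCube_subset_Icc
  · intro i _
    have := hψ.integrable_fderiv_apply (W := fun y => W y i • Pi.single i 1)
      (by have := hW.continuous; fun_prop) (C := C * ‖(Pi.single i 1 : Fin d → ℝ)‖)
      (fun x => by
        rw [norm_smul]
        exact mul_le_mul_of_nonneg_right (hCi i x) (norm_nonneg _))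
      (volume.restrict (unitCube d))
    simpa [mul_comm] using this

end DivergenceFree

section Flow

variable {d : ℕ} {b : (Fin d → ℝ) → Fin d → ℝ} {X : ℝ → (Fin d → ℝ) → Fin d → ℝ} {K : NNReal}

theorem IsFlowOf.continuous_time (hX : IsFlowOf b X) (x : Fin d → ℝ) :
    Continuous fun t => X t x :=
  continuous_iff_continuousAt.2 fun t => ((hX x).2 t).continuousAt

theorem IsFlowOf.eq_of_hasDerivAt (hX : IsFlowOf b X) (hb : LipschitzWith K b)
    {f : ℝ → Fin d → ℝ} (hf : ∀ t, HasDerivAt f (b (f t)) t) (t : ℝ) : f t = X t (f 0) := by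
  have := ODE_solution_unique_univ (v := fun _ => b) (s := fun _ => Set.univ) (K := K) (t₀ := 0)
    (f := f) (g := fun t => X t (f 0)) (fun _ => hb.lipschitzOnWith) (fun t => ⟨hf t, trivial⟩)
    (fun t => ⟨(hX (f 0)).2 t, trivial⟩) (hX (f 0)).1.symm
  exact congrFun this t

theorem IsFlowOf.add_apply (hX : IsFlowOf b X) (hb : LipschitzWith K b) (s t : ℝ)
    (x : Fin d → ℝ) : X (s + t) x = X s (X t x) := by
  have := hX.eq_of_hasDerivAt hb (f := fun s => X (s + t) x)
    (fun s => ((hX x).2 (s + t)).comp_add_const s t) s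
  simpa using this

theorem IsFlowOf.add_int (hX : IsFlowOf b X) (hb : LipschitzWith K b) (hper : ZdPeriodic b)
    (t : ℝ) (κ : Fin d → ℤ) (x : Fin d → ℝ) :
    X t (x + fun i => (κ i : ℝ)) = X t x + fun i => (κ i : ℝ) := by
  have := hX.eq_of_hasDerivAt hb (f := fun s => X s x + fun i => (κ i : ℝ))
    (fun s => by rw [hper]; exact ((hX x).2 s).add_const _) t
  simpa [(hX x).1] using this.symm

theorem IsFlowOf.eq_self_of_eq_zero (hX : IsFlowOf b X) (hb : LipschitzWith K b)
    {x : Fin d → ℝ} (hx : b x = 0) (t : ℝ) : X t x = x :=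
  (hX.eq_of_hasDerivAt hb (f := fun _ => x) (fun s => by rw [hx]; exact hasDerivAt_const s x) t).symm

theorem IsFlowOf.lipschitzWith_of_nonneg (hX : IsFlowOf b X) (hb : LipschitzWith K b)
    {t : ℝ} (ht : 0 ≤ t) : ∃ L, LipschitzWith L (X t) := by
  refine ⟨⟨Real.exp (K * t), (Real.exp_pos _).le⟩, LipschitzWith.of_dist_le_mul fun x y => ?_⟩
  have := dist_le_of_trajectories_ODE (v := fun _ => b) (K := K) (a := 0) (b := t)
    (f := fun s => X s x) (g := fun s => X s y) (δ := dist x y) (fun _ => hb)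
    (hX.continuous_time x).continuousOn (fun s _ => ((hX x).2 s).hasDerivWithinAt)
    (hX.continuous_time y).continuousOn (fun s _ => ((hX y).2 s).hasDerivWithinAt)
    (by rw [(hX x).1, (hX y).1]) t ⟨ht, le_rfl⟩
  rw [sub_zero, mul_comm] at this
  exact this

theorem IsFlowOf.neg (hX : IsFlowOf b X) : IsFlowOf (fun x => -b x) fun t => X (-t) := by
  refine fun x => ⟨by simpa using (hX x).1, fun t => ?_⟩
  have := ((hX x).2 (-t)).scomp t (hasDerivAt_neg t)
  rw [neg_one_smul] at this
  exact this

theorem IsFlowOf.exists_lipschitzWith (hX : IsFlowOf b X) (hb : LipschitzWith K b) (t : ℝ) :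
    ∃ L, LipschitzWith L (X t) := by
  rcases le_total 0 t with ht | ht
  · exact hX.lipschitzWith_of_nonneg hb ht
  · have hb' : LipschitzWith K fun x => -b x :=
      LipschitzWith.of_dist_le_mul fun x y => by
        rw [dist_neg_neg]
        exact hb.dist_le_mul x y
    simpa using hX.neg.lipschitzWith_of_nonneg hb' (neg_nonneg.2 ht)

theorem IsFlowOf.dist_time_le (hX : IsFlowOf b X) {C : ℝ} (hC : ∀ x, ‖b x‖ ≤ C) (s t : ℝ)
    (x : Fin d → ℝ) : dist (X s x) (X t x) ≤ C * dist s t := by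
  rw [dist_eq_norm, dist_eq_norm]
  exact convex_univ.norm_image_sub_le_of_norm_hasDerivWithin_le
    (fun r _ => ((hX x).2 r).hasDerivWithinAt) (fun r _ => hC _) trivial trivial

theorem IsFlowOf.hasDerivAt_integral (hX : IsFlowOf b X) (hb : LipschitzWith K b) {C : ℝ}
    (hC : ∀ x, ‖b x‖ ≤ C) {ψ : (Fin d → ℝ) → ℝ} {L : NNReal} (hψ : LipschitzWith L ψ) {B : ℝ}
    (hB : ∀ x, ‖ψ x‖ ≤ B) (μ : Measure (Fin d → ℝ)) [IsFiniteMeasure μ]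
    (hdiff : ∀ᵐ y ∂μ, DifferentiableAt ℝ ψ y) :
    HasDerivAt (fun h : ℝ => ∫ y, ψ (X h y) ∂μ) (∫ y, fderiv ℝ ψ y (b y) ∂μ) 0 := by
  have hmeas : ∀ t, AEStronglyMeasurable (fun y => ψ (X t y)) μ := fun t => by
    obtain ⟨M, hM⟩ := hX.exists_lipschitzWith hb t
    exact (hψ.continuous.comp hM.continuous).aestronglyMeasurable
  have hC0 : 0 ≤ C := (norm_nonneg _).trans (hC 0)
  refine (hasDerivAt_integral_of_dominated_loc_of_lip (s := Set.univ) (bound := fun _ => L * C)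
    Filter.univ_mem (Filter.Eventually.of_forall hmeas)
    (Integrable.of_bound (hmeas 0) B (ae_of_all _ fun y => hB _))
    (hψ.integrable_fderiv_apply hb.continuous hC μ).aestronglyMeasurable
    (ae_of_all _ fun y => LipschitzOnWith.of_dist_le_mul fun s _ t _ => ?_)
    (integrable_const _) ?_).2
  · rw [Real.coe_nnabs, abs_of_nonneg (by positivity), mul_assoc]
    exact (hψ.dist_le_mul _ _).trans (mul_le_mul_of_nonneg_left (hX.dist_time_le hC s t y) L.2)
  · filter_upwards [hdiff] with y hy
    have h1 := (hX y).2 0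
    have h2 : HasFDerivAt ψ (fderiv ℝ ψ y) (X 0 y) := by rw [(hX y).1]; exact hy.hasFDerivAt
    rw [(hX y).1] at h1
    exact h2.comp_hasDerivAt (0 : ℝ) h1

/-- An invariant measure annihilates the derivatives along the flow. -/
theorem FlowInvariant.integral_fderiv_eq_zero {μ : Measure (Fin d → ℝ)} [IsFiniteMeasure μ]
    (hμ : FlowInvariant X μ) (hX : IsFlowOf b X) (hb : LipschitzWith K b) (hbper : ZdPeriodic b)
    {p : (Fin d → ℝ) → ℝ} (hp : ContDiff ℝ 1 p) (hper : ZdPeriodic p) :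
    ∫ y, fderiv ℝ p y (b y) ∂μ = 0 := by
  obtain ⟨C, -, hC⟩ := hbper.exists_bound hb.continuous
  obtain ⟨B, -, hB⟩ := hper.exists_bound hp.continuous
  obtain ⟨L, hL⟩ := hper.exists_lipschitzWith hp
  have h1 := hX.hasDerivAt_integral hb hC hL hB μ
    (ae_of_all _ fun y => hp.differentiable one_ne_zero y)
  have h2 : (fun h : ℝ => ∫ y, p (X h y) ∂μ) = fun _ => ∫ y, p y ∂μ :=
    funext fun h => hμ h p hp.continuous hper
  rw [h2] at h1
  exact h1.unique (hasDerivAt_const _ _)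

/-- A continuous periodic function is a bounded pointwise limit of Lipschitz periodic functions. -/
theorem ZdPeriodic.exists_seq_lipschitz {ψ : (Fin d → ℝ) → ℝ} (hc : Continuous ψ)
    (hper : ZdPeriodic ψ) : ∃ (B : ℝ) (φ : ℕ → (Fin d → ℝ) → ℝ),
      (∀ n, ZdPeriodic (φ n) ∧ (∃ L, LipschitzWith L (φ n)) ∧ ∀ x, ‖φ n x‖ ≤ B) ∧
      ∀ x, Tendsto (fun n => φ n x) atTop (nhds (ψ x)) := by
  obtain ⟨B, hB0, hB⟩ := hper.exists_bound hc
  let β : ℕ → ContDiffBump (0 : Fin d → ℝ) := fun n =>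
    ⟨1 / ((n : ℝ) + 1) / 2, 1 / ((n : ℝ) + 1), by positivity, half_lt_self (by positivity)⟩
  have hrad : Tendsto (fun n => (β n).rOut) atTop (nhds 0) :=
    tendsto_one_div_add_atTop_nhds_zero_nat
  refine ⟨B + B + B, fun n => convolution ((β n).normed volume) ψ (ContinuousLinearMap.lsmul ℝ ℝ)
    volume, fun n => ?_, fun x => ContDiffBump.convolution_tendsto_right_of_continuous hrad hc x⟩
  have hp : ZdPeriodic (convolution ((β n).normed volume) ψ (ContinuousLinearMap.lsmul ℝ ℝ)
      volume) := by
    intro κ x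
    rw [convolution_def, convolution_def]
    congr 1
    ext t
    rw [add_sub_right_comm, hper κ]
  refine ⟨hp, hp.exists_lipschitzWith ?_, fun x => ?_⟩
  · exact (β n).hasCompactSupport_normed.contDiff_convolution_left _ (β n).contDiff_normed
      hc.locallyIntegrable
  · have h1 := (β n).dist_normed_convolution_le (μ := volume) (x₀ := x) (g := ψ) (ε := B + B)
      hc.aestronglyMeasurable (fun y _ => (dist_eq_norm (ψ y) (ψ x)).trans_le
        ((norm_sub_le _ _).trans (add_le_add (hB _) (hB _))))
    rw [dist_eq_norm] at h1
    have h2 := norm_sub_norm_le (convolution ((β n).normed volume) ψ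
      (ContinuousLinearMap.lsmul ℝ ℝ) volume x) (ψ x)
    linarith [hB x]

/-- A finite absolutely continuous measure which is an infinitesimally invariant measure for a
Lipschitz periodic vector field is invariant for the flow. -/
theorem IsFlowOf.flowInvariant_of_integral_fderiv_eq_zero (hX : IsFlowOf b X)
    (hb : LipschitzWith K b) (hbper : ZdPeriodic b) {μ : Measure (Fin d → ℝ)} [IsFiniteMeasure μ]
    (hμ : μ ≪ volume)
    (h0 : ∀ (ψ : (Fin d → ℝ) → ℝ) (L : NNReal), LipschitzWith L ψ → ZdPeriodic ψ →
      ∫ y, fderiv ℝ ψ y (b y) ∂μ = 0) : FlowInvariant X μ := by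
  obtain ⟨C, -, hC⟩ := hbper.exists_bound hb.continuous
  have hlip : ∀ (t : ℝ) (ψ : (Fin d → ℝ) → ℝ) (L : NNReal), LipschitzWith L ψ → ZdPeriodic ψ →
      ∫ y, ψ (X t y) ∂μ = ∫ y, ψ y ∂μ := by
    intro t ψ L hψ hper
    obtain ⟨B, -, hB⟩ := hper.exists_bound hψ.continuous
    have hder : ∀ s, HasDerivAt (fun s : ℝ => ∫ y, ψ (X s y) ∂μ) 0 s := by
      intro s
      obtain ⟨M, hM⟩ := hX.exists_lipschitzWith hb s
      have hψs : LipschitzWith (L * M) fun y => ψ (X s y) := hψ.comp hM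
      have hpers : ZdPeriodic fun y => ψ (X s y) := fun κ x => by
        simp only [hX.add_int hb hbper, hper κ]
      have h1 := hX.hasDerivAt_integral hb hC hψs (fun x => hB _) μ
        (hμ.ae_le hψs.ae_differentiableAt)
      rw [h0 _ _ hψs hpers] at h1
      have h2 : HasDerivAt (fun h : ℝ => ∫ y, ψ (X s (X h y)) ∂μ) 0 (-s + s) := by simpa using h1
      have h3 := h2.comp_const_add (-s) s
      refine h3.congr_of_eventuallyEq (Filter.Eventually.of_forall fun r => ?_)
      dsimp only
      simp_rw [← hX.add_apply hb]
      simp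
    have := is_const_of_deriv_eq_zero (fun s => (hder s).differentiableAt)
      (fun s => (hder s).deriv) t 0
    simpa only [(hX _).1] using this
  intro t ψ hc hper
  obtain ⟨B, φ, hφ, hlim⟩ := hper.exists_seq_lipschitz hc
  obtain ⟨M, hM⟩ := hX.exists_lipschitzWith hb t
  have hφc : ∀ n, Continuous (φ n) := fun n => (hφ n).2.1.choose_spec.continuous
  have h1 : Tendsto (fun n => ∫ y, φ n y ∂μ) atTop (nhds (∫ y, ψ y ∂μ)) :=
    tendsto_integral_of_dominated_convergence (fun _ => B)
      (fun n => (hφc n).aestronglyMeasurable) (integrable_const _)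
      (fun n => ae_of_all _ (hφ n).2.2) (ae_of_all _ hlim)
  have h2 : Tendsto (fun n => ∫ y, φ n (X t y) ∂μ) atTop (nhds (∫ y, ψ (X t y) ∂μ)) :=
    tendsto_integral_of_dominated_convergence (fun _ => B)
      (fun n => ((hφc n).comp hM.continuous).aestronglyMeasurable) (integrable_const _)
      (fun n => ae_of_all _ fun y => (hφ n).2.2 _) (ae_of_all _ fun y => hlim _)
  have h3 : ∀ n, ∫ y, φ n (X t y) ∂μ = ∫ y, φ n y ∂μ := fun n =>
    hlip t _ _ (hφ n).2.1.choose_spec (hφ n).1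
  simp_rw [h3] at h2
  exact tendsto_nhds_unique h2 h1

end Flow

section Gradient

variable {d : ℕ}

theorem fderiv_apply_eq_sum_grad (u : (Fin d → ℝ) → ℝ) (y v : Fin d → ℝ) :
    fderiv ℝ u y v = ∑ i, grad u y i * v i := by
  conv_lhs => rw [pi_eq_sum_univ' v]
  rw [map_sum]
  refine Finset.sum_congr rfl fun i _ => ?_
  rw [map_smul, smul_eq_mul, mul_comm]
  rfl

theorem contDiff_grad {u : (Fin d → ℝ) → ℝ} (hu : ContDiff ℝ 2 u) : ContDiff ℝ 1 (grad u) := by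
  refine contDiff_pi.2 fun i => ?_
  exact (hu.fderiv_right (m := 1) (by norm_num)).clm_apply contDiff_const

theorem fderiv_grad_apply {u : (Fin d → ℝ) → ℝ} (hu : ContDiff ℝ 2 u) (y v : Fin d → ℝ)
    (j : Fin d) : fderiv ℝ (grad u) y v j = fderiv ℝ (fderiv ℝ u) y v (Pi.single j 1) := by
  have h1 : HasFDerivAt (fderiv ℝ u) (fderiv ℝ (fderiv ℝ u) y) y :=
    ((hu.fderiv_right (m := 1) (by norm_num)).differentiable one_ne_zero y).hasFDerivAt
  have h2 := ((hasFDerivAt_pi'.1 ((contDiff_grad hu).differentiable one_ne_zero y).hasFDerivAt) j)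
  have h3 : HasFDerivAt (fun y => grad u y j) _ y := h1.clm_apply
    (hasFDerivAt_const (Pi.single j 1 : Fin d → ℝ) y)
  have := congrArg (fun f => f v) (h2.unique h3)
  simpa using this

/-- The Hessian is symmetric. -/
theorem fderiv_grad_single_comm {u : (Fin d → ℝ) → ℝ} (hu : ContDiff ℝ 2 u) (y : Fin d → ℝ)
    (i j : Fin d) : fderiv ℝ (grad u) y (Pi.single i 1) j =
      fderiv ℝ (grad u) y (Pi.single j 1) i := by
  rw [fderiv_grad_apply hu, fderiv_grad_apply hu]
  exact (hu.contDiffAt.isSymmSndFDerivAt (by simp)).eq _ _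

/-- A function with periodic gradient is the sum of a linear form and a periodic function. -/
theorem exists_linear_periodic_sub {u : (Fin d → ℝ) → ℝ} (hu : Differentiable ℝ u)
    (hper : ZdPeriodic fun y => grad u y) :
    ∃ ℓ : (Fin d → ℝ) →L[ℝ] ℝ, ZdPeriodic fun x => u x - ℓ x := by
  have hder : ∀ (κ : Fin d → ℤ) x, fderiv ℝ u (x + fun i => (κ i : ℝ)) = fderiv ℝ u x := by
    intro κ x
    ext v
    rw [fderiv_apply_eq_sum_grad, fderiv_apply_eq_sum_grad]
    exact Finset.sum_congr rfl fun i _ => by rw [show grad u _ = _ from hper κ x]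
  have hconst : ∀ (κ : Fin d → ℤ) x,
      u (x + fun i => (κ i : ℝ)) - u x = u (fun i => (κ i : ℝ)) - u 0 := by
    intro κ x
    have h1 : Differentiable ℝ fun x => u (x + fun i => (κ i : ℝ)) := by fun_prop
    have := is_const_of_fderiv_eq_zero (𝕜 := ℝ)
      (f := fun x => u (x + fun i => (κ i : ℝ)) - u x) (h1.sub hu) (fun x => by
        rw [fderiv_fun_sub (h1 x) (hu x), fderiv_comp_add_right, hder, sub_self]) x 0
    simpa using this
  let g : (Fin d → ℤ) →+ ℝ := AddMonoidHom.mk' (fun κ => u (fun i => (κ i : ℝ)) - u 0) (by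
    intro κ κ'
    have h1 := hconst κ' (fun i => (κ i : ℝ))
    have h2 : (fun i => ((κ + κ') i : ℝ)) = (fun i => (κ i : ℝ)) + fun i => (κ' i : ℝ) := by
      ext i; simp
    rw [h2]
    linarith)
  let ℓ : (Fin d → ℝ) →L[ℝ] ℝ := ∑ i, (g (Pi.single i 1)) • ContinuousLinearMap.proj i
  have hℓ : ∀ κ : Fin d → ℤ, ℓ (fun i => (κ i : ℝ)) = g κ := by
    intro κ
    conv_rhs => rw [← Finset.univ_sum_single κ, map_sum]
    rw [_root_.sum_apply]
    refine Finset.sum_congr rfl fun i _ => ?_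
    have : Pi.single i (κ i) = κ i • (Pi.single i 1 : Fin d → ℤ) := by
      rw [← Pi.single_smul]; simp
    rw [this, map_zsmul]
    simp [mul_comm]
  refine ⟨ℓ, fun κ x => ?_⟩
  have h1 := hconst κ x
  have h2 : g κ = u (fun i => (κ i : ℝ)) - u 0 := rfl
  simp only [map_add, hℓ]
  linarith

end Gradient

section CrossProduct

variable {d : ℕ}

theorem contDiff_gcross {v : Fin d → (Fin d → ℝ) → Fin d → ℝ} (hv : ∀ c, ContDiff ℝ 1 (v c)) :
    ContDiff ℝ 1 fun y => gcross fun c => v c y := by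
  refine contDiff_pi.2 fun i => ?_
  simp only [gcross, Matrix.det_apply]
  refine ContDiff.sum fun σ _ => ContDiff.const_smul _ (contDiff_prod fun c _ => ?_)
  by_cases h : (c : ℕ) = 0
  · simp only [Matrix.of_apply, h, if_true]
    exact contDiff_const
  · simp only [Matrix.of_apply, h, if_false]
    exact contDiff_pi.1 (hv c) (σ c)

theorem fderiv_det_apply {M : Fin d → (Fin d → ℝ) → Fin d → ℝ}
    {M' : Fin d → (Fin d → ℝ) →L[ℝ] Fin d → ℝ} {y : Fin d → ℝ}
    (hM : ∀ c, HasFDerivAt (M c) (M' c) y) (v : Fin d → ℝ) :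
    fderiv ℝ (fun y => Matrix.det (Matrix.of fun c => M c y)) y v =
      ∑ c, ((Matrix.of fun c => M c y).updateRow c (M' c v)).det := by
  let D : ContinuousMultilinearMap ℝ (fun _ : Fin d => Fin d → ℝ) ℝ :=
    ⟨(Matrix.detRowAlternating (R := ℝ) (n := Fin d)).toMultilinearMap,
      Continuous.matrix_det continuous_id⟩
  have := HasFDerivAt.multilinear_comp (f := D) hM
  rw [show (fun y => Matrix.det (Matrix.of fun c => M c y)) = fun y => D fun c => M c y from rfl,
    this.fderiv, _root_.sum_apply]
  rfl

variable [NeZero d]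

theorem gcross_apply (v : Fin d → Fin d → ℝ) (i : Fin d) :
    gcross v i = ((Matrix.of v).updateRow 0 (Pi.single i 1)).det := by
  rw [gcross, ← Matrix.det_transpose]
  congr 1
  ext r c
  by_cases h : r = 0 <;> simp [Matrix.updateRow_apply, h]

theorem sum_gcross_mul (v : Fin d → Fin d → ℝ) (x : Fin d → ℝ) :
    ∑ i, gcross v i * x i = ((Matrix.of v).updateRow 0 x).det := by
  have h1 : ∀ i, gcross v i = Matrix.cramer (Matrix.of v)ᵀ (Pi.single i 1) 0 := fun i => by
    rw [gcross_apply, Matrix.cramer_transpose_apply]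
  rw [← Matrix.cramer_transpose_apply]
  conv_rhs => rw [pi_eq_sum_univ' x, map_sum]
  simp [h1, mul_comm]

theorem sum_gcross_mul_self (v : Fin d → Fin d → ℝ) {k : Fin d} (hk : k ≠ 0) :
    ∑ i, gcross v i * v k i = 0 := by
  rw [sum_gcross_mul]
  refine Matrix.det_zero_of_row_eq hk.symm ?_
  ext j
  simp [Matrix.updateRow_apply, hk]

/-- The cross product of gradients is divergence free. -/
theorem sum_fderiv_gcross_grad {u : Fin d → (Fin d → ℝ) → ℝ} (hu : ∀ c, ContDiff ℝ 2 (u c))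
    (y : Fin d → ℝ) :
    ∑ i, fderiv ℝ (fun y => gcross fun c => grad (u c) y) y (Pi.single i 1) i = 0 := by
  have hW := contDiff_gcross fun c => contDiff_grad (hu c)
  set H : Fin d → Fin d → Fin d → ℝ := fun c i j => fderiv ℝ (grad (u c)) y (Pi.single i 1) j
  set R : Matrix (Fin d) (Fin d) ℝ := Matrix.of fun c => grad (u c) y
  have hpart : ∀ i, fderiv ℝ (fun y => gcross fun c => grad (u c) y) y (Pi.single i 1) i =
      ∑ c, if c = 0 then 0 else ((R.updateRow 0 (Pi.single i 1)).updateRow c (H c i)).det := by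
    intro i
    have h1 := ((hasFDerivAt_pi'.1 (hW.differentiable one_ne_zero y).hasFDerivAt) i).fderiv
    have h2 := congrArg (fun f => f (Pi.single i 1)) h1
    simp only [ContinuousLinearMap.comp_apply, ContinuousLinearMap.proj_apply] at h2
    rw [← h2]
    let M : Fin d → (Fin d → ℝ) → Fin d → ℝ := fun c y =>
      if c = 0 then Pi.single i 1 else grad (u c) y
    have h3 : (fun y => gcross (fun c => grad (u c) y) i) =
        fun y => Matrix.det (Matrix.of fun c => M c y) := by
      ext y
      rw [gcross_apply]
      congr 1
      ext c j
      by_cases hc : c = 0 <;> simp [Matrix.updateRow_apply, hc, M]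
    have hM : ∀ c, HasFDerivAt (M c) (if c = 0 then 0 else fderiv ℝ (grad (u c)) y) y := by
      intro c
      by_cases hc : c = 0
      · simp only [M, hc, if_true]
        exact hasFDerivAt_const _ _
      · simp only [M, hc, if_false]
        exact ((contDiff_grad (hu c)).differentiable one_ne_zero y).hasFDerivAt
    rw [h3, fderiv_det_apply hM]
    refine Finset.sum_congr rfl fun c _ => ?_
    by_cases hc : c = 0
    · simp only [hc, if_true]
      exact Matrix.det_eq_zero_of_row_eq_zero 0 (by simp)
    · simp only [hc, if_false]
      congr 2
      ext c j
      by_cases hc : c = 0 <;> simp [Matrix.updateRow_apply, hc, M, R]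
  simp_rw [hpart]
  rw [Finset.sum_comm]
  refine Finset.sum_eq_zero fun c _ => ?_
  by_cases hc : c = 0
  · simp [hc]
  simp only [hc, if_false]
  let D : Fin d → Fin d → ℝ := fun i j =>
    ((R.updateRow 0 (Pi.single i 1)).updateRow c (Pi.single j 1)).det
  have hD : ∀ i j, D i j = - D j i := by
    intro i j
    have h1 : (R.updateRow 0 (Pi.single i 1)).updateRow c (Pi.single j 1) =
        ((R.updateRow 0 (Pi.single j 1)).updateRow c (Pi.single i 1)).submatrix
          (Equiv.swap 0 c) id := by
      ext r s
      by_cases h0 : r = 0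
      · subst h0
        simp [Matrix.updateRow_apply, Ne.symm hc]
      · by_cases h2 : r = c
        · subst h2
          simp [Matrix.updateRow_apply, Ne.symm hc]
        · simp [Matrix.updateRow_apply, h0, h2, Equiv.swap_apply_of_ne_of_ne h0 h2]
    simp only [D, h1]
    rw [Matrix.det_permute, Equiv.Perm.sign_swap (Ne.symm hc)]
    simp
  have hexp : ∀ i, ((R.updateRow 0 (Pi.single i 1)).updateRow c (H c i)).det =
      ∑ j, H c i j * D i j := by
    intro i
    simp only [D, ← Matrix.cramer_transpose_apply]
    conv_lhs => rw [pi_eq_sum_univ' (H c i), map_sum]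
    simp
  simp_rw [hexp]
  have hsymm : ∑ i, ∑ j, H c i j * D i j = - ∑ i, ∑ j, H c i j * D i j := by
    conv_lhs => rw [Finset.sum_comm]
    rw [← Finset.sum_neg_distrib]
    refine Finset.sum_congr rfl fun i _ => ?_
    rw [← Finset.sum_neg_distrib]
    refine Finset.sum_congr rfl fun j _ => ?_
    rw [hD, show H c j i = H c i j from fderiv_grad_single_comm (hu c) y j i]
    ring
  linarith

end CrossProduct

section LinearForms

variable {d : ℕ}

/-- Linear parts of functions with periodic gradients and nonvanishing Jacobian detect
convergence. -/
theorem tendsto_of_tendsto_linear_parts {U : Fin d → (Fin d → ℝ) → ℝ}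
    (hU : ∀ c, Differentiable ℝ (U c)) {ℓ : Fin d → (Fin d → ℝ) →L[ℝ] ℝ}
    (hper : ∀ c, ZdPeriodic fun x => U c x - ℓ c x)
    (hdet : ∀ y, (Matrix.of fun i j : Fin d => grad (U i) y j).det ≠ 0)
    {α : Type*} {F : Filter α} {f : α → Fin d → ℝ} {w : Fin d → ℝ}
    (h : ∀ c, Tendsto (fun t => ℓ c (f t)) F (nhds (ℓ c w))) : Tendsto f F (nhds w) := by
  let M : Matrix (Fin d) (Fin d) ℝ := Matrix.of fun i j => ℓ i (Pi.single j 1)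
  have hMx : ∀ x, M *ᵥ x = fun i => ℓ i x := by
    intro x
    ext i
    conv_rhs => rw [pi_eq_sum_univ' x, map_sum]
    simp only [Matrix.mulVec, dotProduct, M, Matrix.of_apply, map_smul, smul_eq_mul]
    exact Finset.sum_congr rfl fun j _ => mul_comm _ _
  have hM : IsUnit M.det := by
    rw [isUnit_iff_ne_zero]
    intro h0
    obtain ⟨c, hc0, hc⟩ := Matrix.exists_vecMul_eq_zero_iff.2 h0
    let g : (Fin d → ℝ) → ℝ := fun x => ∑ i, c i * (U i x - ℓ i x)
    have hg : Differentiable ℝ g := by fun_prop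
    have hgper : ZdPeriodic g := fun κ x =>
      Finset.sum_congr rfl fun i _ => congrArg (c i * ·) (hper i κ x)
    obtain ⟨x, hx⟩ := hgper.exists_isMaxOn hg.continuous
    have hcrit : fderiv ℝ g x = 0 :=
      IsLocalMax.fderiv_eq_zero (Filter.Eventually.of_forall hx)
    have hder : HasFDerivAt g (∑ i, c i • (fderiv ℝ (U i) x - ℓ i)) x := by
      refine HasFDerivAt.fun_sum fun i _ => ?_
      exact ((hU i x).hasFDerivAt.sub (ℓ i).hasFDerivAt).const_mul (c i)
    rw [hder.fderiv] at hcrit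
    refine hdet x (Matrix.exists_vecMul_eq_zero_iff.1 ⟨c, hc0, ?_⟩)
    ext j
    have h1 := congrArg (fun L => L (Pi.single j 1)) hcrit
    have h2 := congrFun hc j
    simp only [Matrix.vecMul, dotProduct, M, Matrix.of_apply, Pi.zero_apply] at h2
    simp only [_root_.sum_apply, _root_.smul_apply,
      _root_.sub_apply, smul_eq_mul, mul_sub, Finset.sum_sub_distrib, h2,
      sub_zero, _root_.zero_apply] at h1
    simpa [Matrix.vecMul, dotProduct, grad] using h1
  have hinv : ∀ x, M⁻¹ *ᵥ (fun i => ℓ i x) = x := fun x => by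
    rw [← hMx, Matrix.mulVec_mulVec, Matrix.nonsing_inv_mul _ hM, Matrix.one_mulVec]
  have hc : Continuous fun x => M⁻¹ *ᵥ x := by fun_prop
  have := (hc.tendsto (fun i => ℓ i w)).comp (tendsto_pi_nhds.2 h)
  rw [hinv] at this
  exact this.congr fun t => hinv (f t)

theorem fderiv_apply_eq_sub_linear_add {u : (Fin d → ℝ) → ℝ} (hu : Differentiable ℝ u)
    (ℓ : (Fin d → ℝ) →L[ℝ] ℝ) (y v : Fin d → ℝ) :
    fderiv ℝ u y v = fderiv ℝ (fun x => u x - ℓ x) y v + ℓ v := by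
  rw [fderiv_fun_sub (hu y) ℓ.differentiableAt, ℓ.fderiv]
  simp

theorem setIntegral_fderiv_apply_eq {u : (Fin d → ℝ) → ℝ} (hu : ContDiff ℝ 1 u)
    {ℓ : (Fin d → ℝ) →L[ℝ] ℝ} (hper : ZdPeriodic fun x => u x - ℓ x)
    {W : (Fin d → ℝ) → Fin d → ℝ} (hW : ContDiff ℝ 1 W) (hWper : ZdPeriodic W)
    (hdiv : ∀ y, ∑ i, fderiv ℝ W y (Pi.single i 1) i = 0) :
    ∫ y in unitCube d, fderiv ℝ u y (W y) = ℓ (∫ y in unitCube d, W y) := by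
  have hp : ContDiff ℝ 1 fun x => u x - ℓ x := hu.sub ℓ.contDiff
  obtain ⟨L, hL⟩ := hper.exists_lipschitzWith hp
  obtain ⟨C, -, hC⟩ := hWper.exists_bound hW.continuous
  have := isProbabilityMeasure_restrict_unitCube (d := d)
  have hWi : Integrable W (volume.restrict (unitCube d)) :=
    Integrable.of_bound hW.continuous.aestronglyMeasurable C (ae_of_all _ hC)
  simp_rw [fderiv_apply_eq_sub_linear_add (hu.differentiable one_ne_zero) ℓ]
  rw [integral_add (hL.integrable_fderiv_apply hW.continuous hC _) (ℓ.integrable_comp hWi),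
    integral_fderiv_apply_eq_zero hL hper hW hWper hdiv, zero_add, ℓ.integral_comp_comm hWi]

/-- Bounds on the derivative along the flow of a function with linear part `ℓ` bound the
asymptotic speed of the flow measured by `ℓ`. -/
theorem IsFlowOf.exists_bounds_linear {b : (Fin d → ℝ) → Fin d → ℝ}
    {X : ℝ → (Fin d → ℝ) → Fin d → ℝ} (hX : IsFlowOf b X) {u : (Fin d → ℝ) → ℝ}
    (hu : Differentiable ℝ u) {ℓ : (Fin d → ℝ) →L[ℝ] ℝ} (hper : ZdPeriodic fun x => u x - ℓ x)
    {q r : ℝ} (hq : ∀ y, q ≤ fderiv ℝ u y (b y)) (hr : ∀ y, fderiv ℝ u y (b y) ≤ r)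
    (x : Fin d → ℝ) :
    ∃ C, ∀ t > 0, q - C * t⁻¹ ≤ ℓ (t⁻¹ • X t x) ∧ ℓ (t⁻¹ • X t x) ≤ r + C * t⁻¹ := by
  obtain ⟨B, -, hB⟩ := hper.exists_bound (hu.continuous.sub ℓ.continuous)
  have hder : ∀ t, HasDerivAt (fun t => u (X t x)) (fderiv ℝ u (X t x) (b (X t x))) t :=
    fun t => (hu _).hasFDerivAt.comp_hasDerivAt t ((hX x).2 t)
  have hdiff : Differentiable ℝ fun t => u (X t x) := fun t => (hder t).differentiableAt
  refine ⟨|u x| + B, fun t ht => ?_⟩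
  have h1 := mul_sub_le_image_sub_of_le_deriv hdiff (C := q)
    (fun t => by rw [(hder t).deriv]; exact hq _) ht.le
  have h2 := image_sub_le_mul_sub_of_deriv_le hdiff (C := r)
    (fun t => by rw [(hder t).deriv]; exact hr _) ht.le
  simp only [(hX x).1, sub_zero] at h1 h2
  have h3 := abs_le.1 (hB (X t x))
  have h4 := abs_le.1 (le_refl |u x|)
  have ht' : 0 < t⁻¹ := inv_pos.2 ht
  rw [map_smul, smul_eq_mul]
  constructor
  · have : t⁻¹ * (q * t - (|u x| + B)) ≤ t⁻¹ * ℓ (X t x) :=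
      mul_le_mul_of_nonneg_left (by linarith) ht'.le
    refine le_trans (le_of_eq ?_) this
    field_simp
  · have : t⁻¹ * ℓ (X t x) ≤ t⁻¹ * (r * t + (|u x| + B)) :=
      mul_le_mul_of_nonneg_left (by linarith) ht'.le
    refine this.trans (le_of_eq ?_)
    field_simp

end LinearForms

section HarmonicMean

variable {d : ℕ}

/-- The harmonic means of `a ρ_n`, where `ρ_n = 1 / (a J_n)` decreases to `ρ` in the limit,
converge to the harmonic mean of `a ρ`. -/
theorem tendsto_inv_integral_harmonic {a ρ : (Fin d → ℝ) → ℝ} {J : ℕ → (Fin d → ℝ) → ℝ}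
    (hJc : ∀ n, Continuous (J n)) (hJper : ∀ n, ZdPeriodic (J n)) (hapos : ∀ y, 0 < a y)
    (hJpos : ∀ n y, 0 < J n y)
    (hconv : ∀ y, Tendsto (fun n => (a y * J n y)⁻¹) atTop (nhds (ρ y)))
    (hle : ∀ n y, ρ y ≤ (a y * J n y)⁻¹) :
    (∀ n, 0 < ∫ y in unitCube d, J n y) ∧
      Tendsto (fun n => (∫ y in unitCube d, J n y)⁻¹) atTop
        (nhds ((∫⁻ y in unitCube d, (ENNReal.ofReal (a y * ρ y))⁻¹).toReal)⁻¹) := by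
  set L := ∫⁻ y in unitCube d, (ENNReal.ofReal (a y * ρ y))⁻¹
  have := isProbabilityMeasure_restrict_unitCube (d := d)
  have hJi : ∀ n, Integrable (J n) (volume.restrict (unitCube d)) := fun n => by
    obtain ⟨C, -, hC⟩ := (hJper n).exists_bound (hJc n)
    exact Integrable.of_bound (hJc n).aestronglyMeasurable C (ae_of_all _ hC)
  have hpos : ∀ n, 0 < ∫ y in unitCube d, J n y := fun n => by
    rw [integral_pos_iff_support_of_nonneg (fun y => (hJpos n y).le) (hJi n)]
    have : Function.support (J n) = Set.univ := by
      ext y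
      simpa using (hJpos n y).ne'
    simp [this]
  have hI : ∀ n, ENNReal.ofReal (∫ y in unitCube d, J n y) =
      ∫⁻ y in unitCube d, ENNReal.ofReal (J n y) := fun n =>
    ofReal_integral_eq_lintegral_ofReal (hJi n) (ae_of_all _ fun y => (hJpos n y).le)
  have hinv : ∀ n y, ENNReal.ofReal (J n y) = (ENNReal.ofReal (a y * (a y * J n y)⁻¹))⁻¹ := by
    intro n y
    have h1 : a y * (a y * J n y)⁻¹ = (J n y)⁻¹ := by
      rw [mul_inv, mul_inv_cancel_left₀ (hapos y).ne']
    rw [h1, ENNReal.ofReal_inv_of_pos (hJpos n y), inv_inv]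
  have hupper : ∀ n, ENNReal.ofReal (∫ y in unitCube d, J n y) ≤ L := by
    intro n
    rw [hI]
    refine lintegral_mono fun y => ?_
    dsimp only
    rw [hinv]
    exact ENNReal.inv_le_inv.2
      (ENNReal.ofReal_le_ofReal (mul_le_mul_of_nonneg_left (hle n y) (hapos y).le))
  have hlower : L ≤ liminf (fun n => ENNReal.ofReal (∫ y in unitCube d, J n y)) atTop := by
    simp_rw [hI]
    refine le_trans (le_of_eq (lintegral_congr fun y => ?_))
      (lintegral_liminf_le fun n => (hJc n).measurable.ennreal_ofReal)
    simp_rw [hinv]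
    exact ((tendsto_inv_iff.2
      (ENNReal.tendsto_ofReal ((hconv y).const_mul (a y)))).liminf_eq).symm
  have hlim : Tendsto (fun n => ENNReal.ofReal (∫ y in unitCube d, J n y)) atTop (nhds L) :=
    tendsto_of_le_liminf_of_limsup_le hlower
      (Filter.limsup_le_of_le (h := Filter.Eventually.of_forall hupper))
  have hL0 : L ≠ 0 := fun h => by
    have := hupper 0
    rw [h, nonpos_iff_eq_zero, ENNReal.ofReal_eq_zero] at this
    exact absurd (hpos 0) this.not_gt
  refine ⟨hpos, ?_⟩
  have h1 := (ENNReal.tendsto_toReal (ENNReal.inv_ne_top.2 hL0)).comp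
    (tendsto_inv_iff.2 hlim)
  rw [ENNReal.toReal_inv] at h1
  refine h1.congr fun n => ?_
  rw [Function.comp_apply, ENNReal.toReal_inv, ENNReal.toReal_ofReal (hpos n).le]

end HarmonicMean

section RotationSet

variable {d : ℕ} {b : (Fin d → ℝ) → Fin d → ℝ} {X : ℝ → (Fin d → ℝ) → Fin d → ℝ} {K : NNReal}

theorem IsFlowOf.convex_rotationSet (hX : IsFlowOf b X) (hb : LipschitzWith K b)
    (hper : ZdPeriodic b) : Convex ℝ (rotationSet b X) := by
  rintro _ ⟨μ, hμ, hμc, hμi, rfl⟩ _ ⟨ν, hν, hνc, hνi, rfl⟩ s t hs ht hst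
  have hint : ∀ {E : Type} [NormedAddCommGroup E] [NormedSpace ℝ E]
      [SecondCountableTopology E] (f : (Fin d → ℝ) → E), Continuous f → (∃ C, ∀ x, ‖f x‖ ≤ C) →
      ∫ y, f y ∂(ENNReal.ofReal s • μ + ENNReal.ofReal t • ν) =
        s • ∫ y, f y ∂μ + t • ∫ y, f y ∂ν := by
    rintro E _ _ _ f hf ⟨C, hC⟩
    rw [integral_add_measure, integral_smul_measure, integral_smul_measure,
      ENNReal.toReal_ofReal hs, ENNReal.toReal_ofReal ht]
    · exact (Integrable.of_bound hf.aestronglyMeasurable C (ae_of_all _ hC)).smul_measure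
        ENNReal.ofReal_ne_top
    · exact (Integrable.of_bound hf.aestronglyMeasurable C (ae_of_all _ hC)).smul_measure
        ENNReal.ofReal_ne_top
  refine ⟨ENNReal.ofReal s • μ + ENNReal.ofReal t • ν, ⟨?_⟩, ?_, fun r ψ hψ hψper => ?_, ?_⟩
  · simp [← ENNReal.ofReal_add hs ht, hst]
  · simp [hμc, hνc]
  · obtain ⟨C, -, hC⟩ := hψper.exists_bound hψ
    obtain ⟨M, hM⟩ := hX.exists_lipschitzWith hb r
    rw [hint _ hψ ⟨C, hC⟩, hint (fun y => ψ (X r y)) (hψ.comp hM.continuous) ⟨C, fun x => hC _⟩, hμi r ψ hψ hψper,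
      hνi r ψ hψ hψper]
  · obtain ⟨C, -, hC⟩ := hper.exists_bound hb.continuous
    exact (hint b hb.continuous ⟨C, hC⟩).symm

theorem IsFlowOf.zero_mem_rotationSet (hX : IsFlowOf b X) (hb : LipschitzWith K b)
    (hper : ZdPeriodic b) {x : Fin d → ℝ} (hx : b x = 0) : 0 ∈ rotationSet b X := by
  have h0 : b (fun j => Int.fract (x j)) = 0 := (hper.apply_fract x).trans hx
  refine ⟨Measure.dirac fun j => Int.fract (x j), inferInstance, ?_, fun t ψ hψ _ => ?_, ?_⟩
  · rw [Measure.dirac_apply' _ measurableSet_unitCube.compl]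
    simp [fract_mem_unitCube]
  · rw [integral_dirac, integral_dirac, hX.eq_self_of_eq_zero hb h0]
  · rw [integral_dirac, h0]

theorem FlowInvariant.linear_apply_integral {μ : Measure (Fin d → ℝ)} [IsFiniteMeasure μ]
    (hμ : FlowInvariant X μ) (hX : IsFlowOf b X) (hb : LipschitzWith K b) (hbper : ZdPeriodic b)
    {u : (Fin d → ℝ) → ℝ} (hu : ContDiff ℝ 1 u) {ℓ : (Fin d → ℝ) →L[ℝ] ℝ}
    (hper : ZdPeriodic fun x => u x - ℓ x) :
    ℓ (∫ y, b y ∂μ) = ∫ y, fderiv ℝ u y (b y) ∂μ := by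
  have hp : ContDiff ℝ 1 fun x => u x - ℓ x := hu.sub ℓ.contDiff
  obtain ⟨L, hL⟩ := hper.exists_lipschitzWith hp
  obtain ⟨C, -, hC⟩ := hbper.exists_bound hb.continuous
  have hbi : Integrable b μ :=
    Integrable.of_bound hb.continuous.aestronglyMeasurable C (ae_of_all _ hC)
  simp_rw [fderiv_apply_eq_sub_linear_add (hu.differentiable one_ne_zero) ℓ]
  rw [integral_add (hL.integrable_fderiv_apply hb.continuous hC _) (ℓ.integrable_comp hbi),
    hμ.integral_fderiv_eq_zero hX hb hbper hp hper, zero_add, ℓ.integral_comp_comm hbi]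

/-- If `b = g W` with `W` divergence free and `1 / g` integrable, then the probability density
proportional to `1 / g` is invariant. -/
theorem IsFlowOf.smul_integral_mem_rotationSet {W : (Fin d → ℝ) → Fin d → ℝ}
    {g : (Fin d → ℝ) → ℝ} (hg : Continuous g) (hg0 : ∀ y, 0 ≤ g y) (hW : ContDiff ℝ 1 W)
    (hWper : ZdPeriodic W) (hdiv : ∀ y, ∑ i, fderiv ℝ W y (Pi.single i 1) i = 0)
    (hX : IsFlowOf (fun y => g y • W y) X) (hb : LipschitzWith K fun y => g y • W y)
    (hper : ZdPeriodic fun y => g y • W y)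
    (hL0 : ∫⁻ y in unitCube d, (ENNReal.ofReal (g y))⁻¹ ≠ 0)
    (hLtop : ∫⁻ y in unitCube d, (ENNReal.ofReal (g y))⁻¹ ≠ ⊤) :
    ((∫⁻ y in unitCube d, (ENNReal.ofReal (g y))⁻¹).toReal)⁻¹ • ∫ y in unitCube d, W y ∈
      rotationSet (fun y => g y • W y) X := by
  set L := ∫⁻ y in unitCube d, (ENNReal.ofReal (g y))⁻¹
  have hmeas : Measurable fun y => (ENNReal.ofReal (g y))⁻¹ := hg.measurable.ennreal_ofReal.inv
  have hfin : ∀ᵐ y ∂volume.restrict (unitCube d), (ENNReal.ofReal (g y))⁻¹ < ⊤ :=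
    ae_lt_top hmeas hLtop
  set μ : Measure (Fin d → ℝ) :=
    L⁻¹ • (volume.restrict (unitCube d)).withDensity fun y => (ENNReal.ofReal (g y))⁻¹
  have hac : μ ≪ volume.restrict (unitCube d) :=
    (withDensity_absolutelyContinuous _ _).smul_left _
  have hμ : IsProbabilityMeasure μ := ⟨by
    simp only [μ, Measure.smul_apply, withDensity_apply _ MeasurableSet.univ,
      Measure.restrict_univ, smul_eq_mul]
    exact ENNReal.inv_mul_cancel hL0 hLtop⟩
  have hint : ∀ {E : Type} [NormedAddCommGroup E] [NormedSpace ℝ E] (f h : (Fin d → ℝ) → E),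
      (∀ y, f y = g y • h y) → ∫ y, f y ∂μ = L.toReal⁻¹ • ∫ y in unitCube d, h y := by
    intro E _ _ f h hfh
    rw [integral_smul_measure, ENNReal.toReal_inv,
      integral_withDensity_eq_integral_toReal_smul hmeas hfin]
    congr 1
    refine integral_congr_ae ?_
    filter_upwards [hfin] with y hy
    have hgy : 0 < g y := by simpa [ENNReal.inv_lt_top] using hy
    rw [hfh, ENNReal.toReal_inv, ENNReal.toReal_ofReal (hg0 y), inv_smul_smul₀ hgy.ne']
  refine ⟨μ, hμ, ?_, ?_, (hint _ _ fun _ => rfl).symm⟩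
  · refine hac ?_
    rw [Measure.restrict_apply measurableSet_unitCube.compl]
    simp
  · refine hX.flowInvariant_of_integral_fderiv_eq_zero hb hper
      (hac.trans Measure.restrict_le_self.absolutelyContinuous) fun ψ M hψ hψper => ?_
    rw [hint _ (fun y => fderiv ℝ ψ y (W y)) fun y => map_smul _ _ _,
      integral_fderiv_apply_eq_zero hψ hψper hW hWper hdiv, smul_zero]

end RotationSet

/-- Asymptotics of the flow of `b = ρΦ` with
`Φ = a ∇u₂ × ⋯ × ∇u_d` (equal to `a R⊥∇u₂` for `d = 2`), where
`ρ = lim_n 1/(a det ∇U_n)` for `U_n = (u₁ⁿ, u₂, …, u_d)` with positive Jacobian. With `m` the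
harmonic mean of `aρ` and `V = ∫ ∇u₂ × ⋯ × ∇u_d`: the fields `b_n = Φ/(a det ∇U_n)` converge
uniformly to `b`; if `ρ > 0` everywhere then `X(t,x)/t → m V`; if `ρ` vanishes somewhere and
`m = 0` then `X(t,x)/t → 0`; if `ρ` vanishes somewhere and `m > 0` then `C_b = [0, m V]` with
`m V ≠ 0`. -/
theorem flow_asymptotics_jacobian_fields {d : ℕ} (hd : 2 ≤ d)
    (u1 : ℕ → (Fin d → ℝ) → ℝ) (u : Fin d → (Fin d → ℝ) → ℝ)
    (hu1 : ∀ n, ContDiff ℝ 2 (u1 n)) (hu : ∀ c, ContDiff ℝ 2 (u c))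
    (hu1per : ∀ n, ZdPeriodic fun y => grad (u1 n) y)
    (huper : ∀ c, ZdPeriodic fun y => grad (u c) y)
    (a : (Fin d → ℝ) → ℝ) (ha : ContDiff ℝ 1 a) (haper : ZdPeriodic a) (hapos : ∀ y, 0 < a y)
    (J : ℕ → (Fin d → ℝ) → ℝ)
    (hJ : ∀ n y, J n y = Matrix.det (Matrix.of fun i j : Fin d =>
        if (i : ℕ) = 0 then grad (u1 n) y j else grad (u i) y j))
    (hJpos : ∀ n y, 0 < J n y)
    (ρ : (Fin d → ℝ) → ℝ) (hρ : ContDiff ℝ 1 ρ) (hρper : ZdPeriodic ρ)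
    (hconv : TendstoUniformly (fun n y => (a y * J n y)⁻¹) ρ atTop)
    (hle : ∀ n y, ρ y ≤ (a y * J n y)⁻¹)
    (Φ : (Fin d → ℝ) → (Fin d → ℝ))
    (hΦ : Φ = fun y => a y • gcross fun c => grad (u c) y)
    (X : ℝ → (Fin d → ℝ) → (Fin d → ℝ)) (hX : IsFlowOf (fun y => ρ y • Φ y) X)
    (m : ℝ)
    (hm : m = ((∫⁻ y in unitCube d, (ENNReal.ofReal (a y * ρ y))⁻¹).toReal)⁻¹)
    (V : Fin d → ℝ) (hV : V = ∫ y in unitCube d, gcross fun c => grad (u c) y) :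
    TendstoUniformly (fun n y => (a y * J n y)⁻¹ • Φ y) (fun y => ρ y • Φ y) atTop ∧
    ((∀ y, 0 < ρ y) →
      ∀ x, Tendsto (fun t : ℝ => t⁻¹ • X t x) atTop (nhds (m • V))) ∧
    (((∃ x₀, ρ x₀ = 0) ∧ m = 0) →
      ∀ x, Tendsto (fun t : ℝ => t⁻¹ • X t x) atTop (nhds 0)) ∧
    (((∃ x₀, ρ x₀ = 0) ∧ 0 < m) →
      rotationSet (fun y => ρ y • Φ y) X = segment ℝ 0 (m • V) ∧ m • V ≠ 0) := by
  have : NeZero d := ⟨by omega⟩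
  set W : (Fin d → ℝ) → Fin d → ℝ := fun y => gcross fun c => grad (u c) y with hWdef
  have hW : ContDiff ℝ 1 W := contDiff_gcross fun c => contDiff_grad (hu c)
  have hWper : ZdPeriodic W := fun κ x => congrArg gcross (funext fun c => huper c κ x)
  have hdiv : ∀ y, ∑ i, fderiv ℝ W y (Pi.single i 1) i = 0 := sum_fderiv_gcross_grad hu
  have hρ0 : ∀ y, 0 ≤ ρ y := fun y => ge_of_tendsto' (hconv.tendsto_at y) fun n =>
    inv_nonneg.2 (mul_pos (hapos y) (hJpos n y)).le
  have hbeq : (fun y => ρ y • Φ y) = fun y => (a y * ρ y) • W y := by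
    rw [hΦ]
    ext1 y
    rw [smul_smul, mul_comm]
  have hΦper : ZdPeriodic Φ := by
    intro κ x
    simp only [hΦ, haper κ x]
    rw [show (gcross fun c => grad (u c) (x + fun i => (κ i : ℝ))) = _ from hWper κ x]
  have hΦc : Continuous Φ := by
    rw [hΦ]
    exact ha.continuous.smul hW.continuous
  -- the Jacobian as a derivative in the direction of the cross product
  have hJW : ∀ n y, fderiv ℝ (u1 n) y (W y) = J n y := by
    intro n y
    rw [fderiv_apply_eq_sum_grad, hJ]
    simp_rw [mul_comm (grad (u1 n) y _)]
    rw [sum_gcross_mul]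
    congr 1
    ext i j
    by_cases h : i = 0 <;> simp [Matrix.updateRow_apply, h]
  have huW : ∀ k, k ≠ 0 → ∀ y, fderiv ℝ (u k) y (W y) = 0 := by
    intro k hk y
    rw [fderiv_apply_eq_sum_grad]
    simp_rw [mul_comm (grad (u k) y _)]
    exact sum_gcross_mul_self (fun c => grad (u c) y) hk
  have hJc : ∀ n, Continuous (J n) := by
    intro n
    rw [← funext (hJW n)]
    exact ((hu1 n).continuous_fderiv (by norm_num)).clm_apply hW.continuous
  have hJper : ∀ n, ZdPeriodic (J n) := by
    intro n κ x
    rw [hJ, hJ]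
    congr 1
    ext i j
    simp only [Matrix.of_apply]
    rw [show grad (u1 n) (x + fun i => (κ i : ℝ)) = _ from hu1per n κ x,
      show grad (u i) (x + fun i => (κ i : ℝ)) = _ from huper i κ x]
  choose ℓ1 hℓ1 using fun n =>
    exists_linear_periodic_sub ((hu1 n).differentiable (by norm_num)) (hu1per n)
  choose ℓ hℓ using fun c =>
    exists_linear_periodic_sub ((hu c).differentiable (by norm_num)) (huper c)
  have hIV : ∀ n, ∫ y in unitCube d, J n y = ℓ1 n V := by
    intro n
    rw [hV, ← setIntegral_fderiv_apply_eq ((hu1 n).of_le (by norm_num)) (hℓ1 n) hW hWper hdiv]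
    simp_rw [hJW]
  have hℓV : ∀ k, k ≠ 0 → ℓ k V = 0 := by
    intro k hk
    rw [hV, ← setIntegral_fderiv_apply_eq ((hu k).of_le (by norm_num)) (hℓ k) hW hWper hdiv]
    simp_rw [huW k hk]
    simp
  obtain ⟨hIpos, hIlim⟩ := tendsto_inv_integral_harmonic hJc hJper hapos hJpos
    (fun y => hconv.tendsto_at y) hle
  rw [← hm] at hIlim
  simp_rw [hIV] at hIpos hIlim
  -- convergence is detected by the linear parts
  have hlin : ∀ {α : Type} {F : Filter α} {f : α → Fin d → ℝ} {w : Fin d → ℝ},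
      Tendsto (fun t => ℓ1 0 (f t)) F (nhds (ℓ1 0 w)) →
      (∀ k, k ≠ 0 → Tendsto (fun t => ℓ k (f t)) F (nhds (ℓ k w))) → Tendsto f F (nhds w) := by
    intro α F f w h0 hk
    refine tendsto_of_tendsto_linear_parts (U := fun c => if c = 0 then u1 0 else u c)
      (ℓ := fun c => if c = 0 then ℓ1 0 else ℓ c) (fun c => ?_) (fun c => ?_) (fun y => ?_)
      fun c => ?_
    · by_cases hc : c = 0
      · simpa [hc] using (hu1 0).differentiable (by norm_num)
      · simpa [hc] using (hu c).differentiable (by norm_num)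
    · by_cases hc : c = 0
      · simpa [hc] using hℓ1 0
      · simpa [hc] using hℓ c
    · refine ne_of_gt ((hJpos 0 y).trans_eq ?_)
      rw [hJ]
      congr 1
      ext i j
      by_cases hi : i = 0 <;> simp [hi]
    · by_cases hc : c = 0
      · simpa [hc] using h0
      · simpa [hc] using hk c hc
  -- derivatives along the flow
  have hub : ∀ k, k ≠ 0 → ∀ y, fderiv ℝ (u k) y (ρ y • Φ y) = 0 := by
    intro k hk y
    rw [congrFun hbeq y, map_smul, huW k hk, smul_zero]
  have hu1b : ∀ n y, fderiv ℝ (u1 n) y (ρ y • Φ y) = ρ y * (a y * J n y) := by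
    intro n y
    rw [congrFun hbeq y, map_smul, hJW, smul_eq_mul]
    ring
  have haJ : ∀ n y, 0 < a y * J n y := fun n y => mul_pos (hapos y) (hJpos n y)
  have hq0 : ∀ n y, 0 ≤ ρ y * (a y * J n y) := fun n y => mul_nonneg (hρ0 y) (haJ n y).le
  have hq1 : ∀ n y, ρ y * (a y * J n y) ≤ 1 := fun n y =>
    (le_div_iff₀ (haJ n y)).1 ((hle n y).trans_eq (one_div _).symm)
  have key : (∀ η < m, ∃ n q, (∀ y, q ≤ ρ y * (a y * J n y)) ∧ η < q * (ℓ1 n V)⁻¹) →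
      ∀ x, Tendsto (fun t : ℝ => t⁻¹ • X t x) atTop (nhds (m • V)) := by
    intro hq x
    set s : ℝ → ℝ := fun t => ℓ1 0 (t⁻¹ • X t x) / ℓ1 0 V
    set r : ℝ → Fin d → ℝ := fun t => t⁻¹ • X t x - s t • V
    have hCt : ∀ C : ℝ, Tendsto (fun t : ℝ => C * t⁻¹) atTop (nhds 0) := fun C => by
      simpa using tendsto_inv_atTop_zero.const_mul C
    have hr : Tendsto r atTop (nhds 0) := by
      refine hlin ?_ fun k hk => ?_
      · refine tendsto_const_nhds.congr fun t => ?_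
        simp only [r, map_sub, map_smul, smul_eq_mul, s, map_zero]
        have := (hIpos 0).ne'
        field_simp
        simp
      · obtain ⟨C, hC⟩ := hX.exists_bounds_linear ((hu k).differentiable (by norm_num)) (hℓ k)
          (fun y => (hub k hk y).ge) (fun y => (hub k hk y).le) x
        have heq : ∀ t, ℓ k (r t) = ℓ k (t⁻¹ • X t x) := fun t => by
          simp only [r, map_sub, map_smul, hℓV k hk, smul_zero, sub_zero]
        simp_rw [heq, map_zero]
        refine tendsto_of_tendsto_of_tendsto_of_le_of_le' (g := fun t => 0 - C * t⁻¹)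
          (h := fun t => 0 + C * t⁻¹) ?_ ?_ ?_ ?_
        · simpa using (hCt C).neg
        · simpa using hCt C
        · filter_upwards [eventually_gt_atTop 0] with t ht using (hC t ht).1
        · filter_upwards [eventually_gt_atTop 0] with t ht using (hC t ht).2
    have hℓr : ∀ n, Tendsto (fun t => ℓ1 n (r t)) atTop (nhds 0) := fun n => by
      have hlim := ((ℓ1 n).continuous.tendsto 0).comp hr
      rwa [map_zero] at hlim
    have hs : ∀ n t, s t = (ℓ1 n (t⁻¹ • X t x) - ℓ1 n (r t)) * (ℓ1 n V)⁻¹ := by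
      intro n t
      have : ℓ1 n (r t) = ℓ1 n (t⁻¹ • X t x) - s t * ℓ1 n V := by
        simp only [r, map_sub, map_smul, smul_eq_mul]
      rw [this, sub_sub_cancel, mul_inv_cancel_right₀ (hIpos n).ne']
    have hslim : Tendsto s atTop (nhds m) := by
      refine tendsto_order.2 ⟨fun η hη => ?_, fun η hη => ?_⟩
      · obtain ⟨n, q, hqn, hηq⟩ := hq η hη
        obtain ⟨C, hC⟩ := hX.exists_bounds_linear ((hu1 n).differentiable (by norm_num)) (hℓ1 n)
          (fun y => (hqn y).trans_eq (hu1b n y).symm)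
          (fun y => (hu1b n y).trans_le (hq1 n y)) x
        have hlim : Tendsto (fun t => (q - C * t⁻¹ - ℓ1 n (r t)) * (ℓ1 n V)⁻¹) atTop
            (nhds (q * (ℓ1 n V)⁻¹)) := by
          simpa using (((hCt C).const_sub q).sub (hℓr n)).mul_const (ℓ1 n V)⁻¹
        filter_upwards [hlim.eventually_const_lt hηq, eventually_gt_atTop 0] with t ht ht0
        refine ht.trans_le ?_
        rw [hs n]
        have := (hC t ht0).1
        have := hIpos n
        gcongr
      · obtain ⟨n, hn⟩ := (hIlim.eventually_lt_const hη).exists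
        obtain ⟨C, hC⟩ := hX.exists_bounds_linear ((hu1 n).differentiable (by norm_num)) (hℓ1 n)
          (fun y => (hq0 n y).trans_eq (hu1b n y).symm)
          (fun y => (hu1b n y).trans_le (hq1 n y)) x
        have hlim : Tendsto (fun t => (1 + C * t⁻¹ - ℓ1 n (r t)) * (ℓ1 n V)⁻¹) atTop
            (nhds ((ℓ1 n V)⁻¹)) := by
          simpa using (((hCt C).const_add 1).sub (hℓr n)).mul_const (ℓ1 n V)⁻¹
        filter_upwards [hlim.eventually_lt_const hn, eventually_gt_atTop 0] with t ht ht0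
        refine lt_of_le_of_lt ?_ ht
        rw [hs n]
        have := (hC t ht0).2
        have := hIpos n
        gcongr
    have := (hslim.smul_const V).add hr
    simpa [r] using this
  refine ⟨?_, fun hpos => key fun η hη => ?_, fun ⟨_, hm0⟩ => ?_, fun ⟨⟨x₀, hx₀⟩, hmpos⟩ => ?_⟩
  · obtain ⟨C, hC0, hC⟩ := hΦper.exists_bound hΦc
    rw [Metric.tendstoUniformly_iff] at hconv ⊢
    intro ε hε
    filter_upwards [hconv (ε / C) (div_pos hε hC0)] with n hn y
    rw [dist_eq_norm, ← sub_smul, norm_smul, ← dist_eq_norm]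
    calc _ ≤ dist (ρ y) (a y * J n y)⁻¹ * C := mul_le_mul_of_nonneg_left (hC y) dist_nonneg
      _ < ε / C * C := mul_lt_mul_of_pos_right (hn y) hC0
      _ = ε := div_mul_cancel₀ _ hC0.ne'
  · have hmnn : 0 ≤ m := hm ▸ inv_nonneg.2 ENNReal.toReal_nonneg
    rcases lt_or_ge η 0 with hη0 | hη0
    · exact ⟨0, 0, hq0 0, by simpa using hη0⟩
    have hm0 : 0 < m := hη0.trans_lt hη
    obtain ⟨q, hqη, hq1'⟩ := exists_between ((div_lt_one hm0).2 hη)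
    have hqpos : 0 < q := (div_nonneg hη0 hm0.le).trans_lt hqη
    obtain ⟨z, hz⟩ := ZdPeriodic.exists_isMaxOn (f := fun y => -ρ y)
      (fun κ x => congrArg Neg.neg (hρper κ x)) hρ.continuous.neg
    have hε : 0 < (1 - q) * ρ z := mul_pos (sub_pos.2 hq1') (hpos z)
    have hlim : Tendsto (fun n => q * (ℓ1 n V)⁻¹) atTop (nhds (q * m)) := hIlim.const_mul q
    obtain ⟨n, hn1, hn2⟩ := ((hlim.eventually_const_lt ((div_lt_iff₀ hm0).1 hqη)).and
      (Metric.tendstoUniformly_iff.1 hconv _ hε)).exists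
    refine ⟨n, q, fun y => ?_, hn1⟩
    have h1 := (abs_lt.1 (hn2 y)).1
    have h2 : ρ z ≤ ρ y := neg_le_neg_iff.1 (hz y)
    have h3 : q * (a y * J n y)⁻¹ ≤ ρ y := by nlinarith
    calc q = q * (a y * J n y)⁻¹ * (a y * J n y) := by
          rw [inv_mul_cancel_right₀ (haJ n y).ne']
      _ ≤ _ := mul_le_mul_of_nonneg_right h3 (haJ n y).le
  · intro x
    have := key (fun η hη => ⟨0, 0, hq0 0, by simpa [hm0] using hη⟩) x
    simpa [hm0] using this
  · have hbC : ContDiff ℝ 1 fun y => ρ y • Φ y := by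
      rw [hbeq]
      exact (ha.mul hρ).smul hW
    have hbper : ZdPeriodic fun y => ρ y • Φ y := fun κ x => by
      simp only [hρper κ x, hΦper κ x]
    obtain ⟨K, hK⟩ := hbper.exists_lipschitzWith hbC
    have hV0 : V ≠ 0 := by
      rintro rfl
      simpa using hIpos 0
    refine ⟨Set.Subset.antisymm ?_ ?_, smul_ne_zero hmpos.ne' hV0⟩
    · rintro ζ ⟨μ, hμ, -, hinv, rfl⟩
      set ζ := ∫ y, ρ y • Φ y ∂μ
      have hk : ∀ k, k ≠ 0 → ℓ k ζ = 0 := by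
        intro k hk
        rw [hinv.linear_apply_integral hX hK hbper ((hu k).of_le (by norm_num)) (hℓ k)]
        simp_rw [hub k hk]
        simp
      have h1 : ∀ n, ℓ1 n ζ = ∫ y, ρ y * (a y * J n y) ∂μ := by
        intro n
        rw [hinv.linear_apply_integral hX hK hbper ((hu1 n).of_le (by norm_num)) (hℓ1 n)]
        simp_rw [hu1b]
      have hζ : ζ = (ℓ1 0 ζ * (ℓ1 0 V)⁻¹) • V := by
        have : Tendsto (fun _ : ℕ => ζ) atTop (nhds ((ℓ1 0 ζ * (ℓ1 0 V)⁻¹) • V)) := by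
          refine hlin ?_ fun k hk0 => ?_
          · rw [map_smul, smul_eq_mul, inv_mul_cancel_right₀ (hIpos 0).ne']
            exact tendsto_const_nhds
          · rw [map_smul, hℓV k hk0, hk k hk0, smul_zero]
            exact tendsto_const_nhds
        exact tendsto_nhds_unique tendsto_const_nhds this
      set s := ℓ1 0 ζ * (ℓ1 0 V)⁻¹
      have hs0 : 0 ≤ s := by
        refine mul_nonneg ?_ (inv_nonneg.2 (hIpos 0).le)
        rw [h1]
        exact integral_nonneg (hq0 0)
      have hsm : s ≤ m := by
        refine ge_of_tendsto' hIlim fun n => ?_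
        have h2 : s * ℓ1 n V = ℓ1 n ζ := by
          conv_rhs => rw [hζ]
          rw [map_smul, smul_eq_mul]
        have h3 : ℓ1 n ζ ≤ 1 := by
          rw [h1]
          refine (integral_mono_of_nonneg (ae_of_all _ (hq0 n)) (integrable_const (1 : ℝ))
            (ae_of_all _ (hq1 n))).trans_eq ?_
          simp
        rw [← one_div, le_div_iff₀ (hIpos n), h2]
        exact h3
      rw [segment_eq_image]
      refine ⟨s / m, ⟨div_nonneg hs0 hmpos.le, (div_le_one hmpos).2 hsm⟩, ?_⟩
      dsimp only
      rw [smul_zero, zero_add, smul_smul, div_mul_cancel₀ _ hmpos.ne']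
      exact hζ.symm
    · refine (hX.convex_rotationSet hK hbper).segment_subset
        (hX.zero_mem_rotationSet hK hbper (x := x₀) (by simp [hx₀])) ?_
      have hmL := hm ▸ hmpos
      have hL := ENNReal.toReal_pos_iff.1 (inv_pos.1 hmL)
      rw [hbeq] at hX hK hbper ⊢
      have := IsFlowOf.smul_integral_mem_rotationSet (ha.continuous.mul hρ.continuous)
        (fun y => mul_nonneg (hapos y).le (hρ0 y)) hW hWper hdiv hX hK hbper hL.1.ne' hL.2.ne
      rw [hm, hV]
      exact this
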